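/- arXiv:1904.06622 — 2 statements merged into one kernel-verified Lean document; each statement's English description precedes it below -/
import Mathlib

section
/- Let m ≥ 1, let w_0 be a complex number, and let w_1, …, w_{2m} be complex numbers with indices taken modulo 2m. Define η_i := w_{2i−1}·w_{2i+1} − w_0·w_{2i} (indices of η modulo m) and assume η_i ≠ 0 and w_{2i+1} ≠ w_0 for all i. If the region equation ∏_{i=1}^m ((w_{2i−1} − w_0)(w_{2i+1} − w_0))/η_i = 1 holds, then there exist nonzero complex numbers q_1, …, q_m (indices modulo m) such that q_i²·η_{i+1} = q_{i+1}²·(w_{2i+1} − w_0)² for every i. Moreover the collection (q_i²) is unique up to a common nonzero scalar. -/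
/-- The doubled index `2i` of `i : ZMod m`, viewed in `ZMod (2m)`. -/
def dblIdx (m : ℕ) (i : ZMod m) : ZMod (2 * m) := ((2 * i.val : ℕ) : ZMod (2 * m))

/-- `η_i = w_{2i−1}·w_{2i+1} − w_0·w_{2i}` with `w`-indices modulo `2m`. -/
def etaOf (m : ℕ) (w0 : ℂ) (w : ZMod (2 * m) → ℂ) (i : ZMod m) : ℂ :=
  w (dblIdx m i - 1) * w (dblIdx m i + 1) - w0 * w (dblIdx m i)

theorem dblIdx_natCast (m n : ℕ) : dblIdx m (n : ZMod m) = ((2 * n : ℕ) : ZMod (2 * m)) := by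
  unfold dblIdx
  rw [ZMod.natCast_eq_natCast_iff, ZMod.val_natCast]
  exact Nat.ModEq.mul_left' 2 (Nat.mod_modEq n m)

theorem dblIdx_succ (m : ℕ) [NeZero m] (i : ZMod m) : dblIdx m (i + 1) = dblIdx m i + 2 := by
  obtain ⟨n, rfl⟩ := ZMod.natCast_zmod_surjective i
  have h := dblIdx_natCast m (n + 1)
  push_cast at h
  rw [h, dblIdx_natCast]
  push_cast
  ring

theorem zmod_ind (m : ℕ) [NeZero m] (P : ZMod m → Prop) (h0 : P 0)
    (hs : ∀ i, P i → P (i + 1)) (i : ZMod m) : P i := by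
  obtain ⟨n, rfl⟩ := ZMod.natCast_zmod_surjective i
  induction n with
  | zero => simpa using h0
  | succ k ih => simpa using hs _ ih

theorem prod_range_zmod (m : ℕ) [NeZero m] (r : ZMod m → ℂ) :
    ∏ k ∈ Finset.range m, r (k : ZMod m) = ∏ i, r i := by
  refine Finset.prod_bij (fun k _ => (k : ZMod m)) (by simp) ?_ ?_ (by simp)
  · intro a ha b hb hab
    rw [Finset.mem_range] at ha hb
    have := congrArg ZMod.val hab
    rwa [ZMod.val_natCast_of_lt ha, ZMod.val_natCast_of_lt hb] at this
  · intro b _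
    exact ⟨b.val, Finset.mem_range.2 (ZMod.val_lt b), ZMod.natCast_zmod_val b⟩

theorem exists_cyc (m : ℕ) [NeZero m] (r : ZMod m → ℂ) (hr : ∀ i, r i ≠ 0)
    (hp : ∏ i, r i = 1) :
    ∃ Q : ZMod m → ℂ, (∀ i, Q i ≠ 0) ∧ ∀ i, Q (i + 1) = Q i * r i := by
  have key : ∀ i : ZMod m, ∏ k ∈ Finset.range (i + 1).val, r (k : ZMod m) =
      (∏ k ∈ Finset.range i.val, r (k : ZMod m)) * r i := by
    intro i
    have e : (∏ k ∈ Finset.range i.val, r (k : ZMod m)) * r i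
        = ∏ k ∈ Finset.range (i.val + 1), r (k : ZMod m) := by
      rw [Finset.prod_range_succ, ZMod.natCast_zmod_val]
    rw [e]
    have hv : (i + 1).val = (i.val + 1) % m := by
      rw [← ZMod.val_natCast]
      simp
    have hl := ZMod.val_lt i
    rcases Nat.lt_or_ge (i.val + 1) m with h | h
    · rw [hv, Nat.mod_eq_of_lt h]
    · have h' : i.val + 1 = m := by omega
      rw [hv, h', Nat.mod_self, prod_range_zmod, hp]
      simp
  exact ⟨fun i => ∏ k ∈ Finset.range i.val, r (k : ZMod m),
    fun i => Finset.prod_ne_zero_iff.2 fun k _ => hr _, key⟩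

open Finset in
/-- Existence (and uniqueness up to a common nonzero scalar of the squares) of the
octahedron scaling parameters `q_i` with `q_i²·η_{i+1} = q_{i+1}²·(w_{2i+1}−w_0)²`,
given the region equation of `T₅` for an `m`-gonal region with alternating boundary. -/
theorem exists_unique_q_scaling (m : ℕ) [NeZero m] (hm : 1 ≤ m) (w0 : ℂ)
    (w : ZMod (2 * m) → ℂ)
    (hη : ∀ i : ZMod m, etaOf m w0 w i ≠ 0)
    (hw : ∀ i : ZMod m, w (dblIdx m i + 1) ≠ w0)
    (hglue : ∏ i : ZMod m,
      ((w (dblIdx m i - 1) - w0) * (w (dblIdx m i + 1) - w0)) / etaOf m w0 w i = 1) :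
    (∃ q : ZMod m → ℂ, (∀ i, q i ≠ 0) ∧
      ∀ i : ZMod m,
        (q i) ^ 2 * etaOf m w0 w (i + 1) = (q (i + 1)) ^ 2 * (w (dblIdx m i + 1) - w0) ^ 2) ∧
    (∀ q q' : ZMod m → ℂ, (∀ i, q i ≠ 0) →
      (∀ i : ZMod m,
        (q i) ^ 2 * etaOf m w0 w (i + 1) = (q (i + 1)) ^ 2 * (w (dblIdx m i + 1) - w0) ^ 2) →
      (∀ i, q' i ≠ 0) →
      (∀ i : ZMod m,
        (q' i) ^ 2 * etaOf m w0 w (i + 1) = (q' (i + 1)) ^ 2 * (w (dblIdx m i + 1) - w0) ^ 2) →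
      ∃ t : ℂ, t ≠ 0 ∧ ∀ i, (q' i) ^ 2 = t * (q i) ^ 2) := by
  have hb : ∀ i : ZMod m, w (dblIdx m i + 1) - w0 ≠ 0 := fun i => sub_ne_zero.2 (hw i)
  constructor
  · have hp : ∏ i : ZMod m, (etaOf m w0 w (i + 1) / (w (dblIdx m i + 1) - w0) ^ 2) = 1 := by
      have e1 : ∏ i : ZMod m, etaOf m w0 w (i + 1) = ∏ i : ZMod m, etaOf m w0 w i :=
        Equiv.prod_comp (Equiv.addRight (1 : ZMod m)) (fun i => etaOf m w0 w i)
      have e2 : ∏ i : ZMod m, (w (dblIdx m i + 1) - w0) =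
          ∏ i : ZMod m, (w (dblIdx m i - 1) - w0) := by
        rw [← Equiv.prod_comp (Equiv.addRight (1 : ZMod m))
          (fun i => w (dblIdx m i - 1) - w0)]
        refine Finset.prod_congr rfl fun i _ => ?_
        simp only [Equiv.coe_addRight, dblIdx_succ]
        congr 2
        ring
      have hE : ∏ i : ZMod m, etaOf m w0 w i ≠ 0 := Finset.prod_ne_zero_iff.2 fun i _ => hη i
      rw [Finset.prod_div_distrib, Finset.prod_mul_distrib, ← e2, div_eq_one_iff_eq hE] at hglue
      rw [Finset.prod_div_distrib, Finset.prod_pow, e1, ← hglue, sq]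
      rw [hglue]
      exact div_self hE
    obtain ⟨Q, hQ, hQs⟩ := exists_cyc m _
      (fun i => div_ne_zero (hη (i + 1)) (pow_ne_zero 2 (hb i))) hp
    choose q hq using fun i => (⟨_, (Complex.cpow_nat_inv_pow (Q i) two_ne_zero).symm⟩ : ∃ z, Q i = z ^ 2)
    refine ⟨q, fun i h => hQ i (by rw [hq i, h]; simp), fun i => ?_⟩
    rw [← hq, ← hq, hQs]
    have := hb i
    field_simp
  · intro q q' hq h hq' h'
    refine ⟨q' 0 ^ 2 / q 0 ^ 2, div_ne_zero (pow_ne_zero 2 (hq' 0)) (pow_ne_zero 2 (hq 0)), ?_⟩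
    refine zmod_ind m _ ?_ ?_
    · have := hq 0
      field_simp
    · intro i hi
      apply mul_right_cancel₀ (pow_ne_zero 2 (hb i))
      rw [← h' i, hi, mul_assoc, mul_assoc, ← h i]
end

section
/- Let w_a, w_b, w_c, w_d be complex numbers with w_a ≠ w_b, w_c ≠ w_d, w_a·w_c ≠ w_b·w_d, and S := w_a − w_b + w_c − w_d ≠ 0. Set v_b := w_a/(w_a − w_b), v_d := w_d/(w_d − w_c), and v_0 := (w_a − w_d)/S. Then 1/(v_b − v_0) − 1/(v_d − v_0) = S²/(w_a·w_c − w_b·w_d). -/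
/-- The quantity `Λ` of equation (3.7): `1/(v_b − v_0) − 1/(v_d − v_0) = S²/(w_a w_c − w_b w_d)`. -/
theorem lambda_identity (wa wb wc wd : ℂ)
    (hab : wa ≠ wb) (hcd : wc ≠ wd) (hac : wa * wc ≠ wb * wd)
    (hS : wa - wb + wc - wd ≠ 0) :
    let S : ℂ := wa - wb + wc - wd
    let vb : ℂ := wa / (wa - wb)
    let vd : ℂ := wd / (wd - wc)
    let v0 : ℂ := (wa - wd) / S
    1 / (vb - v0) - 1 / (vd - v0) = S ^ 2 / (wa * wc - wb * wd) := by
  intro S vb vd v0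
  have h1 : wa - wb ≠ 0 := sub_ne_zero.mpr hab
  have h2 : wd - wc ≠ 0 := sub_ne_zero.mpr hcd.symm
  have h3 : wa * wc - wb * wd ≠ 0 := sub_ne_zero.mpr hac
  have hS' : S ≠ 0 := hS
  have e1 : vb - v0 = (wa * wc - wb * wd) / ((wa - wb) * S) := by
    simp only [vb, v0]
    rw [div_sub_div _ _ h1 hS']
    congr 1
    simp only [S]
    ring
  have e2 : vd - v0 = (wa * wc - wb * wd) / ((wd - wc) * S) := by
    simp only [vd, v0]
    rw [div_sub_div _ _ h2 hS']
    congr 1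
    simp only [S]
    ring
  rw [e1, e2, one_div_div, one_div_div, ← sub_div]
  congr 1
  simp only [S]
  ring
end
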